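/- Let Q be a σ-finite stationary non-zero measure on M with intensity λ_Q ∈ (0,∞), such that Q-almost every ν satisfies condition (R). Then the Palm distribution admits the time-changed representation: for every measurable G ⊆ M, 𝔓_Q(G) = (1/λ_Q) ∫ ∫_0^{ν((0,1])} 1{ θ_{−ν^{−1}(x)} ν ∈ G } dx Q(dν). -/

import Mathlib

open MeasureTheory Filter Set
open scoped ENNReal NNReal

noncomputable section

/-- The additive functional of a locally finite Borel measure on `ℝ`:
`ν_t = ν((0,t])` for `t > 0` and `ν_t = -ν((t,0])` for `t ≤ 0`. -/
def addFun (ν : Measure ℝ) (t : ℝ) : ℝ :=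
  if 0 < t then (ν (Set.Ioc 0 t)).toReal else -((ν (Set.Ioc t 0)).toReal)

/-- The right-continuous inverse `ν⁻¹(x) = inf {t : ν_t > x}` of the additive functional. -/
def rcInv (ν : Measure ℝ) (x : ℝ) : ℝ :=
  sInf {t : ℝ | x < addFun ν t}

/-- The shift `θ_{-t}` acting on measures: `(θ_{-t} ν)(A) = ν(A + t)`. -/
def mshift (t : ℝ) (ν : Measure ℝ) : Measure ℝ :=
  Measure.map (fun s => s - t) ν

/-- The random time shift `θ̂_x ν = θ_{-ν⁻¹(x)} ν`, i.e. `(θ̂_x ν)(A) = ν(A + ν⁻¹(x))`. -/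
def rtShift (x : ℝ) (ν : Measure ℝ) : Measure ℝ :=
  mshift (rcInv ν x) ν

/-- `ν` satisfies condition (R): the range of its additive functional is all of `ℝ`. -/
def CondR (ν : Measure ℝ) : Prop :=
  Set.range (addFun ν) = Set.univ

lemma addFun_of_nonneg (ν : Measure ℝ) {t : ℝ} (ht : 0 ≤ t) :
    addFun ν t = (ν (Set.Ioc 0 t)).toReal := by
  unfold addFun
  split_ifs with h
  · rfl
  · have : t = 0 := le_antisymm (not_lt.mp h) ht
    simp [this]

lemma pos_of_addFun_pos (ν : Measure ℝ) {t : ℝ} (ht : 0 < addFun ν t) : 0 < t := by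
  by_contra h
  unfold addFun at ht
  rw [if_neg h] at ht
  have := ENNReal.toReal_nonneg (a := ν (Set.Ioc t 0))
  linarith

lemma addFun_le_of_le (ν : Measure ℝ) {s t : ℝ} (hs : 0 < s) (hst : s ≤ t)
    (hfin : ν (Set.Ioc 0 t) ≠ ⊤) : addFun ν s ≤ addFun ν t := by
  rw [addFun_of_nonneg ν hs.le, addFun_of_nonneg ν (hs.le.trans hst)]
  exact ENNReal.toReal_mono hfin (measure_mono (Set.Ioc_subset_Ioc_right hst))

lemma fin_of_addFun_pos (ν : Measure ℝ) {t : ℝ} (ht : 0 < addFun ν t) :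
    ν (Set.Ioc 0 t) ≠ ⊤ := by
  intro h
  rw [addFun_of_nonneg ν (pos_of_addFun_pos ν ht).le, h] at ht
  simp at ht

lemma rcInv_le (ν : Measure ℝ) {x t : ℝ} (hx : 0 < x) (h : x < addFun ν t) :
    rcInv ν x ≤ t :=
  csInf_le ⟨0, fun _ hs => (pos_of_addFun_pos ν (hx.trans hs)).le⟩ h

lemma lt_rcInv (ν : Measure ℝ) (hR : CondR ν) {x t : ℝ} (ht : 0 ≤ t)
    (hfin : ν (Set.Ioc 0 t) ≠ ⊤) (h1 : x < addFun ν 1) (h : addFun ν t < x) :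
    t < rcInv ν x := by
  obtain ⟨y, hy1, hy2⟩ := exists_between h
  obtain ⟨t', rfl⟩ : y ∈ Set.range (addFun ν) := by rw [hR]; trivial
  have h0 : 0 ≤ addFun ν t := by rw [addFun_of_nonneg ν ht]; exact ENNReal.toReal_nonneg
  have hp : 0 < addFun ν t' := h0.trans_lt hy1
  have ht' := pos_of_addFun_pos ν hp
  have hlt : t < t' := by
    by_contra hc
    have := addFun_le_of_le ν ht' (not_lt.mp hc) hfin
    linarith
  refine hlt.trans_le (le_csInf ⟨1, h1⟩ fun s hs => ?_)
  have hs : x < addFun ν s := hs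
  by_contra hc
  have := addFun_le_of_le ν (pos_of_addFun_pos ν (by linarith)) (not_le.mp hc).le
    (fin_of_addFun_pos ν hp)
  linarith

lemma aemeasurable_rcInv (ν : Measure ℝ) :
    AEMeasurable (rcInv ν) (volume.restrict (Set.Ioo 0 ((ν (Set.Ioc (0:ℝ) 1)).toReal))) := by
  refine aemeasurable_restrict_of_monotoneOn measurableSet_Ioo ?_
  intro x hx y hy hxy
  refine le_csInf ⟨1, ?_⟩ fun s hs => rcInv_le ν hx.1 (hxy.trans_lt hs)
  change y < addFun ν 1
  rw [addFun_of_nonneg ν zero_le_one]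
  exact hy.2

lemma map_rcInv (ν : Measure ℝ) (hR : CondR ν) (hfin : ν (Set.Ioc 0 1) ≠ ⊤) :
    Measure.map (rcInv ν) (volume.restrict (Set.Ioo 0 ((ν (Set.Ioc (0:ℝ) 1)).toReal)))
      = ν.restrict (Set.Ioc 0 1) := by
  have : IsFiniteMeasure (ν.restrict (Set.Ioc (0:ℝ) 1)) :=
    ⟨by rw [Measure.restrict_apply_univ]; exact hfin.lt_top⟩
  have : IsFiniteMeasure
      (volume.restrict (Set.Ioo 0 ((ν (Set.Ioc (0:ℝ) 1)).toReal))) :=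
    ⟨by rw [Measure.restrict_apply_univ]; exact measure_Ioo_lt_top⟩
  symm
  refine Measure.ext_of_Iic _ _ fun t => ?_
  rw [Measure.map_apply_of_aemeasurable (aemeasurable_rcInv ν) measurableSet_Iic,
    Measure.restrict_apply' measurableSet_Ioo, Measure.restrict_apply' measurableSet_Ioc]
  obtain ⟨u, hu⟩ : ∃ u, u = max 0 (min t 1) := ⟨_, rfl⟩
  have hu0 : 0 ≤ u := hu ▸ le_max_left _ _
  have hu1 : u ≤ 1 := hu ▸ max_le zero_le_one (min_le_right _ _)
  have hm : min t 1 ≤ u := hu ▸ le_max_right _ _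
  have hut : 0 < u → u ≤ t := by
    intro h
    rcases max_choice 0 (min t 1) with h' | h'
    · rw [← hu] at h'; linarith
    · rw [hu, h']; exact min_le_left _ _
  have hset : Set.Iic t ∩ Set.Ioc 0 1 = Set.Ioc 0 u := by
    ext z
    simp only [Set.mem_inter_iff, Set.mem_Iic, Set.mem_Ioc]
    constructor
    · rintro ⟨a, b, c⟩
      exact ⟨b, (le_min a c).trans hm⟩
    · rintro ⟨a, b⟩
      exact ⟨b.trans (hut (a.trans_le b)), a, b.trans hu1⟩
  have hufin : ν (Set.Ioc 0 u) ≠ ⊤ :=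
    ((measure_mono (Set.Ioc_subset_Ioc_right hu1)).trans_lt hfin.lt_top).ne
  have hF1 := addFun_of_nonneg ν zero_le_one
  have hFu1 : addFun ν u ≤ addFun ν 1 := by
    rw [addFun_of_nonneg ν hu0, hF1]
    exact ENNReal.toReal_mono hfin (measure_mono (Set.Ioc_subset_Ioc_right hu1))
  have hval : ν (Set.Ioc 0 u) = ENNReal.ofReal (addFun ν u) := by
    rw [addFun_of_nonneg ν hu0, ENNReal.ofReal_toReal hufin]
  rw [hset, hval, ← hF1]
  apply le_antisymm
  · have h1 : Set.Ioo 0 (addFun ν u) ⊆ rcInv ν ⁻¹' Set.Iic t ∩ Set.Ioo 0 (addFun ν 1) := by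
      rintro x ⟨a, b⟩
      exact ⟨(rcInv_le ν a b).trans (hut (pos_of_addFun_pos ν (a.trans b))), a,
        b.trans_le hFu1⟩
    calc _ = volume (Set.Ioo 0 (addFun ν u)) := by rw [Real.volume_Ioo, sub_zero]
      _ ≤ _ := measure_mono h1
  · have h1 : rcInv ν ⁻¹' Set.Iic t ∩ Set.Ioo 0 (addFun ν 1) ⊆ Set.Ioc 0 (addFun ν u) := by
      rintro x ⟨c, a, b⟩
      refine ⟨a, ?_⟩
      by_contra hc
      have h2 := lt_rcInv ν hR hu0 hufin b (not_le.mp hc)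
      have h3 : rcInv ν x ≤ t := c
      have h4 := (le_min h3 (rcInv_le ν a b)).trans hm
      linarith
    calc _ ≤ volume (Set.Ioc 0 (addFun ν u)) := measure_mono h1
      _ = _ := by rw [Real.volume_Ioc, sub_zero]

lemma measurable_mshift_time (ν : Measure ℝ) [SFinite ν] :
    Measurable (fun t => mshift t ν) := by
  refine Measure.measurable_of_measurable_coe _ fun s hs => ?_
  have h : (fun t => mshift t ν s)
      = fun t => ν (Prod.mk t ⁻¹' ((fun p : ℝ × ℝ => p.2 - p.1) ⁻¹' s)) := by
    funext t
    unfold mshift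
    rw [Measure.map_apply (by fun_prop) hs]
    rfl
  rw [h]
  exact measurable_measure_prodMk_left ((by fun_prop : Measurable _) hs)

lemma measurable_mshift (t : ℝ) : Measurable (mshift t) :=
  Measure.measurable_map _ (by fun_prop)

lemma sigmaFinite_of_Ioc (ν : Measure ℝ)
    (h : ∀ k : ℤ, ν (Set.Ioc (k : ℝ) (k + 1)) < ⊤) : SigmaFinite ν := by
  refine ⟨⟨⟨fun n => (Encodable.decode (α := ℤ) n).elim ∅ fun k => Set.Ioc (k : ℝ) (k + 1),
    fun _ => trivial, fun n => ?_, ?_⟩⟩⟩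
  · cases Encodable.decode (α := ℤ) n with
    | none => simp
    | some k => exact h k
  · refine Set.eq_univ_of_forall fun x => Set.mem_iUnion.2 ?_
    have := iUnion_Ioc_intCast ℝ
    obtain ⟨k, hk⟩ := Set.mem_iUnion.1 (this ▸ Set.mem_univ x)
    refine ⟨Encodable.encode k, ?_⟩
    rw [Encodable.encodek]
    exact hk

/-- **Time-changed representation of the Palm distribution.** For a σ-finite stationary
non-zero measure `Q` with intensity `λ_Q ∈ (0,∞)` such that `Q`-a.e. `ν` satisfies (R),
the Palm distribution satisfies
`𝔓_Q(G) = λ_Q⁻¹ ∫ ∫_0^{ν((0,1])} 1{θ_{-ν⁻¹(x)} ν ∈ G} dx Q(dν)`. -/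
theorem palm_time_changed_representation
    (Q : Measure (Measure ℝ)) [SigmaFinite Q]
    (hstat : ∀ t : ℝ, Measure.map (mshift t) Q = Q)
    (hnz : Q {(0 : Measure ℝ)} = 0)
    (lamQ : ℝ≥0∞) (hlam : lamQ = ∫⁻ ν, ν (Set.Ioc 0 1) ∂Q)
    (hlam0 : 0 < lamQ) (hlamfin : lamQ < ⊤)
    (hR : ∀ᵐ ν ∂Q, CondR ν)
    (P : Measure (Measure ℝ)) [IsProbabilityMeasure P]
    (hP : ∀ G : Set (Measure ℝ), MeasurableSet G →
      P G = lamQ⁻¹ * ∫⁻ ν, ν {t ∈ Set.Ioc (0 : ℝ) 1 | mshift t ν ∈ G} ∂Q) :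
    ∀ G : Set (Measure ℝ), MeasurableSet G →
      P G = lamQ⁻¹ *
        ∫⁻ ν, volume {x : ℝ | x ∈ Set.Ioo 0 ((ν (Set.Ioc (0:ℝ) 1)).toReal) ∧
          mshift (rcInv ν x) ν ∈ G} ∂Q := by
  intro G hG
  rw [hP G hG]
  congr 1
  have hfin : ∀ k : ℤ, ∀ᵐ ν ∂Q, ν (Set.Ioc (k : ℝ) (k + 1)) < ⊤ := by
    intro k
    refine ae_lt_top (Measure.measurable_coe measurableSet_Ioc) ?_
    have h1 : ∫⁻ ν, ν (Set.Ioc (k : ℝ) (k + 1)) ∂Q = ∫⁻ ν, ν (Set.Ioc 0 1) ∂Q := by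
      conv_rhs => rw [← hstat k]
      rw [lintegral_map (Measure.measurable_coe measurableSet_Ioc) (measurable_mshift _)]
      refine lintegral_congr fun ν => ?_
      unfold mshift
      rw [Measure.map_apply (by fun_prop) measurableSet_Ioc]
      congr 1
      ext z
      simp only [Set.mem_Ioc, Set.mem_preimage]
      constructor <;> rintro ⟨a, b⟩ <;> constructor <;> linarith
    rw [h1, ← hlam]
    exact hlamfin.ne
  refine lintegral_congr_ae ?_
  filter_upwards [hR, ae_all_iff.2 hfin] with ν hν hk
  have := sigmaFinite_of_Ioc ν hk
  have h01 : ν (Set.Ioc 0 1) ≠ ⊤ := by simpa using (hk 0).ne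
  have hS : MeasurableSet {t | mshift t ν ∈ G} := measurable_mshift_time ν hG
  have key := congrArg (fun μ => μ {t | mshift t ν ∈ G}) (map_rcInv ν hν h01)
  rw [Measure.map_apply_of_aemeasurable (aemeasurable_rcInv ν) hS,
    Measure.restrict_apply' measurableSet_Ioo, Measure.restrict_apply' measurableSet_Ioc,
    Set.inter_comm, Set.inter_comm _ (Set.Ioc (0:ℝ) 1)] at key
  exact key.symm

end
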